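/- arXiv:2003.02618 — 2 statements merged into one kernel-verified Lean document; each statement's English description precedes it below -/
import Mathlib

section
/- Let h be a smooth solution of the Hele-Shaw equation on [0,T]. Then the Rayleigh–Taylor coefficient is strictly positive: a(t,x) = 1 − B(t,x) > 0 for every (t,x) ∈ [0,T]×𝕋ⁿ. -/
open MeasureTheory
open scoped Classical

noncomputable section

/-- ℤⁿ-periodicity for functions on ℝⁿ (model for functions on the torus 𝕋ⁿ = ℝⁿ/ℤⁿ). -/
def ZPeriodic (n : ℕ) (f : (Fin n → ℝ) → ℝ) : Prop :=
  ∀ (x : Fin n → ℝ) (k : Fin n → ℤ), f (x + fun i => (k i : ℝ)) = f x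

/-- ℤⁿ-periodicity in the horizontal variable for functions on ℝⁿ × ℝ. -/
def ZPeriodicE (n : ℕ) (φ : (Fin n → ℝ) × ℝ → ℝ) : Prop :=
  ∀ (x : Fin n → ℝ) (y : ℝ) (k : Fin n → ℤ), φ (x + fun i => (k i : ℝ), y) = φ (x, y)

/-- Fundamental cell of the torus 𝕋ⁿ. -/
def cell (n : ℕ) : Set (Fin n → ℝ) := Set.univ.pi fun _ => Set.Ico (0:ℝ) 1

/-- i-th partial derivative of a function on ℝⁿ. -/
def pdX (n : ℕ) (f : (Fin n → ℝ) → ℝ) (i : Fin n) (x : Fin n → ℝ) : ℝ :=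
  fderiv ℝ f x (Pi.single i 1)

/-- Directional derivative of a function on ℝⁿ × ℝ. -/
def pdE (n : ℕ) (φ : (Fin n → ℝ) × ℝ → ℝ) (v : (Fin n → ℝ) × ℝ)
    (p : (Fin n → ℝ) × ℝ) : ℝ := fderiv ℝ φ p v

def eX (n : ℕ) (i : Fin n) : (Fin n → ℝ) × ℝ := (Pi.single i 1, 0)
def eY (n : ℕ) : (Fin n → ℝ) × ℝ := (0, 1)

/-- Laplacian Δ_{x,y} on ℝⁿ × ℝ. -/
def lapE (n : ℕ) (φ : (Fin n → ℝ) × ℝ → ℝ) (p : (Fin n → ℝ) × ℝ) : ℝ :=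
  (∑ i, pdE n (pdE n φ (eX n i)) (eX n i) p) + pdE n (pdE n φ (eY n)) (eY n) p

/-- |∇_{x,y}φ|². -/
def gradSqE (n : ℕ) (φ : (Fin n → ℝ) × ℝ → ℝ) (p : (Fin n → ℝ) × ℝ) : ℝ :=
  (∑ i, (pdE n φ (eX n i) p)^2) + (pdE n φ (eY n) p)^2

/-- One periodic cell of the fluid domain Ω(h) = {y < h(x)}. -/
def fluidCell (n : ℕ) (h : (Fin n → ℝ) → ℝ) : Set ((Fin n → ℝ) × ℝ) :=
  {p | p.1 ∈ cell n ∧ p.2 < h p.1}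

/-- φ is the harmonic extension of ψ to Ω(h) = {y < h(x)}: it is harmonic in Ω(h),
has boundary value ψ, is periodic in x, and has square-integrable gradient. -/
structure IsHarmonicExt (n : ℕ) (h ψ : (Fin n → ℝ) → ℝ)
    (φ : (Fin n → ℝ) × ℝ → ℝ) : Prop where
  smooth : ContDiff ℝ (⊤ : ℕ∞) φ
  periodic : ZPeriodicE n φ
  harmonic : ∀ p : (Fin n → ℝ) × ℝ, p.2 < h p.1 → lapE n φ p = 0
  boundary : ∀ x, φ (x, h x) = ψ x
  gradL2 : IntegrableOn (gradSqE n φ) (fluidCell n h)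

/-- The Dirichlet-to-Neumann operator:
(G(h)ψ)(x) = ∂_yφ(x,h(x)) − ∇h(x)·∇_xφ(x,h(x)), where φ is the harmonic extension of ψ. -/
def DtN (n : ℕ) (h ψ : (Fin n → ℝ) → ℝ) : (Fin n → ℝ) → ℝ :=
  if H : ∃ φ, IsHarmonicExt n h ψ φ then
    fun x => pdE n H.choose (eY n) (x, h x)
      - ∑ i, pdX n h i x * pdE n H.choose (eX n i) (x, h x)
  else 0

/-- (B(h)ψ)(x) = ∂_yφ(x,h(x)). -/
def Bop (n : ℕ) (h ψ : (Fin n → ℝ) → ℝ) : (Fin n → ℝ) → ℝ :=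
  if H : ∃ φ, IsHarmonicExt n h ψ φ then
    fun x => pdE n H.choose (eY n) (x, h x)
  else 0

/-- (V(h)ψ)(x) = ∇_xφ(x,h(x)). -/
def Vop (n : ℕ) (h ψ : (Fin n → ℝ) → ℝ) : (Fin n → ℝ) → Fin n → ℝ :=
  if H : ∃ φ, IsHarmonicExt n h ψ φ then
    fun x i => pdE n H.choose (eX n i) (x, h x)
  else 0

/-- Divergence of a vector field on the torus. -/
def divX (n : ℕ) (W : (Fin n → ℝ) → Fin n → ℝ) (x : Fin n → ℝ) : ℝ :=
  ∑ i, pdX n (fun z => W z i) i x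

/-- h is a smooth solution of the Hele-Shaw equation ∂ₜh + G(h)h = 0 on [0,T]. -/
structure IsHeleShawSol (n : ℕ) (T : ℝ) (h : ℝ → (Fin n → ℝ) → ℝ) : Prop where
  smooth : ContDiff ℝ (⊤ : ℕ∞) (Function.uncurry h)
  periodic : ∀ t : ℝ, ZPeriodic n (h t)
  extension : ∀ t ∈ Set.Icc 0 T, ∃ φ, IsHarmonicExt n (h t) (h t) φ
  equation : ∀ t ∈ Set.Icc 0 T, ∀ x, deriv (fun s => h s x) t + DtN n (h t) (h t) x = 0

/-- B(t,x) = (B(h(t,·))h(t,·))(x). -/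
def HSB (n : ℕ) (h : ℝ → (Fin n → ℝ) → ℝ) (t : ℝ) (x : Fin n → ℝ) : ℝ :=
  Bop n (h t) (h t) x

/-- V(t,x) = (V(h(t,·))h(t,·))(x). -/
def HSV (n : ℕ) (h : ℝ → (Fin n → ℝ) → ℝ) (t : ℝ) (x : Fin n → ℝ) : Fin n → ℝ :=
  Vop n (h t) (h t) x

/-- The Rayleigh–Taylor coefficient a = 1 − B. -/
def HSa (n : ℕ) (h : ℝ → (Fin n → ℝ) → ℝ) (t : ℝ) (x : Fin n → ℝ) : ℝ :=
  1 - HSB n h t x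

/-- γ = (1+|∇h|²)⁻¹ ( G(h)(B²+|V|²) − 2B G(h)B − 2V·G(h)V ). -/
def HSgamma (n : ℕ) (h : ℝ → (Fin n → ℝ) → ℝ) (t : ℝ) (x : Fin n → ℝ) : ℝ :=
  (1 + ∑ i, (pdX n (h t) i x)^2)⁻¹ *
    ( DtN n (h t) (fun z => (HSB n h t z)^2 + ∑ i, (HSV n h t z i)^2) x
      - 2 * HSB n h t x * DtN n (h t) (fun z => HSB n h t z) x
      - 2 * ∑ i, HSV n h t x i * DtN n (h t) (fun z => HSV n h t z i) x )

/-- L(h)f = −V·∇f − ½(div V)f + √a G(h)(√a f). -/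
def Lop (n : ℕ) (h : ℝ → (Fin n → ℝ) → ℝ) (t : ℝ) (f : (Fin n → ℝ) → ℝ)
    (x : Fin n → ℝ) : ℝ :=
  - (∑ i, HSV n h t x i * pdX n f i x)
  - (1/2) * divX n (HSV n h t) x * f x
  + Real.sqrt (HSa n h t x) * DtN n (h t) (fun z => Real.sqrt (HSa n h t z) * f z) x


theorem pdE_contDiff (n : ℕ) {f : (Fin n → ℝ) × ℝ → ℝ} (hf : ContDiff ℝ (⊤ : ℕ∞) f)
    (v : (Fin n → ℝ) × ℝ) : ContDiff ℝ (⊤ : ℕ∞) (pdE n f v) := by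
  unfold pdE
  exact (hf.fderiv_right (m := (⊤ : ℕ∞)) (by simp)).clm_apply contDiff_const

theorem pdE_comm (n : ℕ) {f : (Fin n → ℝ) × ℝ → ℝ} (hf : ContDiff ℝ (⊤ : ℕ∞) f)
    (v w p : (Fin n → ℝ) × ℝ) : pdE n (pdE n f v) w p = pdE n (pdE n f w) v p := by
  have hs : IsSymmSndFDerivAt ℝ f p :=
    hf.contDiffAt.isSymmSndFDerivAt (by simp only [minSmoothness_of_isRCLikeNormedField]; exact WithTop.coe_le_coe.2 le_top)
  have hd : DifferentiableAt ℝ (fderiv ℝ f) p :=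
    ((hf.fderiv_right (m := (⊤ : ℕ∞)) (by simp)).differentiable (by simp)) p
  have key : ∀ a b : (Fin n → ℝ) × ℝ, pdE n (pdE n f a) b p = fderiv ℝ (fderiv ℝ f) p b a := by
    intro a b
    unfold pdE
    rw [fderiv_clm_apply hd (differentiableAt_const a)]
    simp
  rw [key, key]
  exact hs w v

/-- Euclidean square norm. -/
def nsq (n : ℕ) (z : (Fin n → ℝ) × ℝ) : ℝ := (∑ i, (z.1 i)^2) + z.2^2

/-- Averaging kernel. -/
def ker (n : ℕ) (z : (Fin n → ℝ) × ℝ) : ℝ := max (1 - nsq n z) 0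

theorem hasDerivAt_maxsq (t : ℝ) : HasDerivAt (fun t : ℝ => (max t 0)^2) (2 * max t 0) t := by
  rcases lt_trichotomy t 0 with ht | ht | ht
  · have : (fun t : ℝ => (max t 0)^2) =ᶠ[nhds t] fun _ => 0 := by
      filter_upwards [gt_mem_nhds ht] with s hs
      simp [max_eq_right hs.le]
    rw [max_eq_right ht.le]
    simpa using (hasDerivAt_const t (0:ℝ)).congr_of_eventuallyEq this
  · subst ht
    simp only [max_self, mul_zero]
    rw [hasDerivAt_iff_isLittleO_nhds_zero]
    simp only [zero_add, max_self, smul_zero, sub_zero, ne_eq, OfNat.ofNat_ne_zero, not_false_eq_true, zero_pow]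
    have h1 : (fun t : ℝ => (max t 0)^2) =O[nhds 0] fun t : ℝ => t^2 := by
      apply Asymptotics.isBigO_of_le
      intro x
      rw [norm_pow, norm_pow]
      apply pow_le_pow_left₀ (norm_nonneg _)
      rcases le_total x 0 with h | h
      · simp [max_eq_right h]
      · simp [max_eq_left h]
    refine h1.trans_isLittleO ?_
    simpa using (Asymptotics.isLittleO_pow_pow (𝕜 := ℝ) (m := 1) (n := 2) (by norm_num))
  · have : (fun t : ℝ => (max t 0)^2) =ᶠ[nhds t] fun s => s^2 := by
      filter_upwards [lt_mem_nhds ht] with s hs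
      simp [max_eq_left hs.le]
    rw [max_eq_left ht.le]
    simpa using (hasDerivAt_pow 2 t).congr_of_eventuallyEq this

theorem nsq_continuous (n : ℕ) : Continuous (nsq n) := by
  unfold nsq; fun_prop

theorem ker_continuous (n : ℕ) : Continuous (ker n) := by
  unfold ker
  exact (continuous_const.sub (nsq_continuous n)).max continuous_const

theorem nsq_nonneg (n : ℕ) (z : (Fin n → ℝ) × ℝ) : 0 ≤ nsq n z := by
  unfold nsq; positivity

theorem nsq_coord (n : ℕ) {z : (Fin n → ℝ) × ℝ} (hz : nsq n z ≤ 1) :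
    (∀ i, |z.1 i| ≤ 1) ∧ |z.2| ≤ 1 := by
  have h0 : 0 ≤ ∑ i, (z.1 i)^2 := by positivity
  unfold nsq at hz
  constructor
  · intro i
    have := Finset.single_le_sum (f := fun i => (z.1 i)^2) (fun i _ => sq_nonneg _) (Finset.mem_univ i)
    rw [← sq_le_one_iff_abs_le_one]
    nlinarith [sq_nonneg z.2]
  · rw [← sq_le_one_iff_abs_le_one]
    linarith

theorem ker_zero (n : ℕ) {z : (Fin n → ℝ) × ℝ} (hz : 1 < nsq n z) : ker n z = 0 := by
  unfold ker
  exact max_eq_right (by linarith)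

theorem ker_support (n : ℕ) : HasCompactSupport (ker n) := by
  apply HasCompactSupport.intro (isCompact_closedBall (0 : (Fin n → ℝ) × ℝ) 1)
  intro z hz
  apply ker_zero
  by_contra h
  push Not at h
  apply hz
  rw [mem_closedBall_zero_iff, Prod.norm_def]
  obtain ⟨h1, h2⟩ := nsq_coord n h
  refine max_le ?_ h2
  exact (pi_norm_le_iff_of_nonneg zero_le_one).2 h1

theorem ker_nonneg (n : ℕ) (z : (Fin n → ℝ) × ℝ) : 0 ≤ ker n z := le_max_right _ _

theorem ker_le_one (n : ℕ) (z : (Fin n → ℝ) × ℝ) : ker n z ≤ 1 :=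
  max_le (by linarith [nsq_nonneg n z]) zero_le_one

theorem ker_int_pos (n : ℕ) : 0 < ∫ z, ker n z := by
  apply (ker_continuous n).integral_pos_of_hasCompactSupport_nonneg_nonzero (ker_support n)
    (ker_nonneg n) (x := 0)
  simp [ker, nsq]

theorem hasFDerivAt_nsq (n : ℕ) (z : (Fin n → ℝ) × ℝ) :
    ∃ L : (Fin n → ℝ) × ℝ →L[ℝ] ℝ, HasFDerivAt (nsq n) L z ∧
      (∀ i, L (eX n i) = 2 * z.1 i) ∧ L (eY n) = 2 * z.2 := by
  have h1 : ∀ i, HasFDerivAt (fun z : (Fin n → ℝ) × ℝ => z.1 i)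
      ((ContinuousLinearMap.proj i).comp (ContinuousLinearMap.fst ℝ (Fin n → ℝ) ℝ)) z := fun i =>
    ((ContinuousLinearMap.proj (R := ℝ) (φ := fun _ : Fin n => ℝ) i).comp
      (ContinuousLinearMap.fst ℝ (Fin n → ℝ) ℝ)).hasFDerivAt
  have h2 : HasFDerivAt (fun z : (Fin n → ℝ) × ℝ => z.2) (ContinuousLinearMap.snd ℝ (Fin n → ℝ) ℝ) z :=
    (ContinuousLinearMap.snd ℝ (Fin n → ℝ) ℝ).hasFDerivAt
  refine ⟨_, (HasFDerivAt.fun_sum (u := Finset.univ) fun i _ => (h1 i).pow 2).add (h2.pow 2), ?_, ?_⟩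
  · intro i
    simp [eX, Pi.single_apply]
  · simp [eY]

theorem pdE_kersq (n : ℕ) (z : (Fin n → ℝ) × ℝ) :
    DifferentiableAt ℝ (fun z => (ker n z)^2) z ∧
    (∀ i, pdE n (fun z => (ker n z)^2) (eX n i) z = - 4 * z.1 i * ker n z) ∧
    pdE n (fun z => (ker n z)^2) (eY n) z = - 4 * z.2 * ker n z := by
  obtain ⟨L, hL, h1, h2⟩ := hasFDerivAt_nsq n z
  have h3 := (hasDerivAt_maxsq (1 - nsq n z)).comp_hasFDerivAt z (hL.const_sub 1)
  have h4 : HasFDerivAt (fun z => (ker n z)^2) ((2 * max (1 - nsq n z) 0) • (-L)) z := h3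
  refine ⟨h4.differentiableAt, ?_, ?_⟩
  · intro i
    unfold pdE
    rw [h4.fderiv]
    simp [h1, ker]; ring
  · unfold pdE
    rw [h4.fderiv]
    simp [h2, ker]; ring

theorem vec_decomp (n : ℕ) (z : (Fin n → ℝ) × ℝ) :
    z = (∑ i, z.1 i • eX n i) + z.2 • eY n := by
  have : ∀ i, eX n i = ContinuousLinearMap.inl ℝ (Fin n → ℝ) ℝ (Pi.single i 1) := by
    intro i; simp [eX]
  simp only [this, ← map_smul, ← map_sum]
  ext j
  · rw [map_sum]
    simp [eY, Prod.fst_sum, Finset.sum_apply, Pi.single_apply]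
  · rw [map_sum]
    simp [eY, Prod.snd_sum]

theorem fderiv_decomp (n : ℕ) (f : (Fin n → ℝ) × ℝ → ℝ) (q z : (Fin n → ℝ) × ℝ) :
    fderiv ℝ f q z = (∑ i, z.1 i * pdE n f (eX n i) q) + z.2 * pdE n f (eY n) q := by
  conv_lhs => rw [vec_decomp n z]
  simp [pdE]

theorem ibp (n : ℕ) {F : (Fin n → ℝ) × ℝ → ℝ} (hF : ContDiff ℝ (⊤ : ℕ∞) F)
    (p : (Fin n → ℝ) × ℝ) (r : ℝ) (v : (Fin n → ℝ) × ℝ)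
    (hv : Continuous (pdE n (fun z => (ker n z)^2) v)) 
    (hvs : HasCompactSupport (pdE n (fun z => (ker n z)^2) v)) :
    ∫ z, F (p + r • z) * pdE n (fun z => (ker n z)^2) v z
      = - ∫ z, (r * pdE n F v (p + r • z)) * (ker n z)^2 := by
  have hd : ∀ z, HasFDerivAt (fun z => F (p + r • z)) 
      ((fderiv ℝ F (p + r • z)).comp (r • ContinuousLinearMap.id ℝ _)) z := by
    intro z
    apply ((hF.differentiable (by simp)) _).hasFDerivAt.comp
    exact ((hasFDerivAt_id z).const_smul r).const_add p
  have hd2 : ∀ z, fderiv ℝ (fun z => F (p + r • z)) z v = r * pdE n F v (p + r • z) := by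
    intro z
    rw [(hd z).fderiv]
    simp [pdE]
  have hk2 : HasCompactSupport (fun z => (ker n z)^2) := by
    simp only [pow_two]; exact (ker_support n).mul_left (f := ker n)
  have hkc : Continuous (fun z => (ker n z)^2) := (ker_continuous n).pow 2
  have hFc := hF.continuous
  have hPc := (pdE_contDiff n hF v).continuous
  have : (volume : Measure ((Fin n → ℝ) × ℝ)).IsAddHaarMeasure :=
    Measure.prod.instIsAddHaarMeasure (volume : Measure (Fin n → ℝ)) (volume : Measure ℝ)
  have := integral_mul_fderiv_eq_neg_fderiv_mul_of_integrable (μ := volume) 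
    (f := fun z => F (p + r • z)) (g := fun z => (ker n z)^2) (v := v) ?_ ?_ ?_ ?_ ?_
  · simp only [hd2] at this
    exact this
  · simp only [hd2]
    exact Continuous.integrable_of_hasCompactSupport (by fun_prop) hk2.mul_left
  · exact Continuous.integrable_of_hasCompactSupport (f := fun z => F (p + r • z) * pdE n (fun z => (ker n z)^2) v z) (by fun_prop) hvs.mul_left
  · exact Continuous.integrable_of_hasCompactSupport (by fun_prop) hk2.mul_left
  · intro z _; exact (hd z).differentiableAt
  · intro z _; exact (pdE_kersq n z).1

theorem avg_deriv (n : ℕ) {f : (Fin n → ℝ) × ℝ → ℝ} (hf : ContDiff ℝ (⊤ : ℕ∞) f)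
    (p : (Fin n → ℝ) × ℝ) (r : ℝ) :
    HasDerivAt (fun r => ∫ z, f (p + r • z) * ker n z)
      (∫ z, fderiv ℝ f (p + r • z) z * ker n z) r := by
  have hfc := hf.continuous
  have hfd : Continuous (fderiv ℝ f) := hf.continuous_fderiv (by simp)
  have hkc := ker_continuous n
  have hcont : Continuous (fun q : ℝ × ((Fin n → ℝ) × ℝ) => fderiv ℝ f (p + q.1 • q.2) q.2) := by
    fun_prop
  obtain ⟨C, hC⟩ := ((isCompact_closedBall r 1).prod 
    (isCompact_closedBall (0 : (Fin n → ℝ) × ℝ) 1)).exists_bound_of_continuousOn hcont.continuousOn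
  refine (hasDerivAt_integral_of_dominated_loc_of_deriv_le (μ := volume)
    (F := fun r z => f (p + r • z) * ker n z)
    (F' := fun r z => fderiv ℝ f (p + r • z) z * ker n z) (bound := fun z => C * ker n z)
    (Metric.closedBall_mem_nhds r zero_lt_one) ?_ ?_ ?_ ?_ ?_ ?_).2
  · exact Filter.Eventually.of_forall fun s => Continuous.aestronglyMeasurable (by fun_prop)
  · exact Continuous.integrable_of_hasCompactSupport (by fun_prop) (ker_support n).mul_left
  · exact Continuous.aestronglyMeasurable (by fun_prop)
  · refine Filter.Eventually.of_forall fun z s hs => ?_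
    rw [norm_mul, Real.norm_of_nonneg (ker_nonneg n z)]
    by_cases hz : nsq n z ≤ 1
    · obtain ⟨h1, h2⟩ := nsq_coord n hz
      have hz' : z ∈ Metric.closedBall (0 : (Fin n → ℝ) × ℝ) 1 := by
        rw [mem_closedBall_zero_iff, Prod.norm_def]
        exact max_le ((pi_norm_le_iff_of_nonneg zero_le_one).2 h1) h2
      exact mul_le_mul_of_nonneg_right (hC (s, z) ⟨hs, hz'⟩) (ker_nonneg n z)
    · simp [ker_zero n (not_le.1 hz)]
  · exact Continuous.integrable_of_hasCompactSupport (by fun_prop) (ker_support n).mul_left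
  · refine Filter.Eventually.of_forall fun z s hs => ?_
    apply HasDerivAt.mul_const
    have h1 : HasDerivAt (fun s : ℝ => p + s • z) z s := by
      simpa using ((hasDerivAt_id s).smul_const z).const_add p
    exact ((hf.differentiable (by simp)) _).hasFDerivAt.comp_hasDerivAt s h1

theorem avg_deriv_zero (n : ℕ) {f : (Fin n → ℝ) × ℝ → ℝ} (hf : ContDiff ℝ (⊤ : ℕ∞) f)
    (p : (Fin n → ℝ) × ℝ) (r : ℝ) 
    (hl : ∀ z, nsq n z ≤ 1 → lapE n f (p + r • z) = 0) :
    ∫ z, fderiv ℝ f (p + r • z) z * ker n z = 0 := by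
  have hkc := ker_continuous n
  have hX : ∀ i, pdE n (fun z => (ker n z)^2) (eX n i) = fun z => (- 4 * z.1 i) * ker n z :=
    fun i => funext fun z => (pdE_kersq n z).2.1 i
  have hY : pdE n (fun z => (ker n z)^2) (eY n) = fun z => (- 4 * z.2) * ker n z :=
    funext fun z => (pdE_kersq n z).2.2
  have cX : ∀ i, Continuous (pdE n (fun z => (ker n z)^2) (eX n i)) := by
    intro i; rw [hX]; fun_prop
  have cY : Continuous (pdE n (fun z => (ker n z)^2) (eY n)) := by
    rw [hY]; fun_prop
  have sX : ∀ i, HasCompactSupport (pdE n (fun z => (ker n z)^2) (eX n i)) := by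
    intro i; rw [hX]; exact (ker_support n).mul_left
  have sY : HasCompactSupport (pdE n (fun z => (ker n z)^2) (eY n)) := by
    rw [hY]; exact (ker_support n).mul_left
  have hk2 : HasCompactSupport (fun z => (ker n z)^2) := by
    simp only [pow_two]; exact (ker_support n).mul_left (f := ker n)
  have dX : ∀ v, Continuous (pdE n f v) := fun v => (pdE_contDiff n hf v).continuous
  have ddX : ∀ v, Continuous (pdE n (pdE n f v) v) := fun v => 
    (pdE_contDiff n (pdE_contDiff n hf v) v).continuous
  have e1 : ∀ z, fderiv ℝ f (p + r • z) z * ker n z = 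
      (-1/4) * ((∑ i, pdE n f (eX n i) (p + r • z) * pdE n (fun z => (ker n z)^2) (eX n i) z)
        + pdE n f (eY n) (p + r • z) * pdE n (fun z => (ker n z)^2) (eY n) z) := by
    intro z
    rw [fderiv_decomp, hY]
    simp only [hX]
    rw [add_mul, mul_add, Finset.sum_mul, Finset.mul_sum]
    congr 1
    · apply Finset.sum_congr rfl; intro i _; ring
    · ring
  simp only [e1]
  rw [integral_const_mul, integral_add, integral_finsetSum, ibp n (pdE_contDiff n hf _) p r _ cY sY]
  · simp only [fun i => ibp n (pdE_contDiff n hf (eX n i)) p r _ (cX i) (sX i)]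
    have e2 : (∑ i, - ∫ z, (r * pdE n (pdE n f (eX n i)) (eX n i) (p + r • z)) * (ker n z)^2)
        + - ∫ z, (r * pdE n (pdE n f (eY n)) (eY n) (p + r • z)) * (ker n z)^2 =
        - ∫ z, r * lapE n f (p + r • z) * (ker n z)^2 := by
      rw [Finset.sum_neg_distrib, ← neg_add, ← integral_finsetSum, ← integral_add]
      · congr 2
        funext z
        simp only [lapE, ← Finset.sum_mul, ← Finset.mul_sum]
        ring
      · apply integrable_finsetSum
        intro i _
        have := ddX (eX n i)
        exact Continuous.integrable_of_hasCompactSupport (by fun_prop) hk2.mul_left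
      · have := ddX (eY n)
        exact Continuous.integrable_of_hasCompactSupport (by fun_prop) hk2.mul_left
      · intro i _
        have := ddX (eX n i)
        exact Continuous.integrable_of_hasCompactSupport (by fun_prop) hk2.mul_left
    rw [e2]
    have e3 : ∀ z, r * lapE n f (p + r • z) * (ker n z)^2 = 0 := by
      intro z
      by_cases hz : nsq n z ≤ 1
      · simp [hl z hz]
      · simp [ker_zero n (not_le.1 hz)]
    simp [e3]
  · intro i _
    have h1 := dX (eX n i)
    have h2 := cX i
    exact Continuous.integrable_of_hasCompactSupport (by fun_prop) (sX i).mul_left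
  · apply integrable_finsetSum
    intro i _
    have h1 := dX (eX n i)
    have h2 := cX i
    exact Continuous.integrable_of_hasCompactSupport (by fun_prop) (sX i).mul_left
  · have h1 := dX (eY n)
    exact Continuous.integrable_of_hasCompactSupport (by fun_prop) sY.mul_left

theorem mvp (n : ℕ) {f : (Fin n → ℝ) × ℝ → ℝ} (hf : ContDiff ℝ (⊤ : ℕ∞) f)
    (p : (Fin n → ℝ) × ℝ) (hl : ∀ z, nsq n z ≤ 1 → lapE n f (p + z) = 0) :
    ∫ z, f (p + z) * ker n z = f p * ∫ z, ker n z := by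
  have hc : ∀ r ∈ Set.Icc (0:ℝ) 1, (∫ z, f (p + r • z) * ker n z) 
      = ∫ z, f (p + (0:ℝ) • z) * ker n z := by
    apply constant_of_has_deriv_right_zero
    · exact fun r _ => (avg_deriv n hf p r).continuousAt.continuousWithinAt
    · intro r hr
      have := avg_deriv n hf p r
      rw [avg_deriv_zero n hf p r] at this
      · exact this.hasDerivWithinAt
      · intro z hz
        apply hl
        have : nsq n (r • z) = r^2 * nsq n z := by
          simp [nsq, mul_pow, ← Finset.mul_sum]; ring
        rw [this]
        have h0 := nsq_nonneg n z
        have : r^2 ≤ 1 := by nlinarith [hr.1, hr.2]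
        nlinarith
  have := hc 1 ⟨zero_le_one, le_rfl⟩
  simpa [integral_const_mul] using this

theorem line_hasDerivAt (n : ℕ) {f : (Fin n → ℝ) × ℝ → ℝ} (hf : ContDiff ℝ (⊤ : ℕ∞) f)
    (p v : (Fin n → ℝ) × ℝ) (s : ℝ) :
    HasDerivAt (fun s : ℝ => f (p + s • v)) (pdE n f v (p + s • v)) s := by
  have h1 : HasDerivAt (fun s : ℝ => p + s • v) v s := by
    simpa using ((hasDerivAt_id s).smul_const v).const_add p
  exact ((hf.differentiable (by simp)) _).hasFDerivAt.comp_hasDerivAt s h1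

theorem snd_nonneg_of_localMin (n : ℕ) {f : (Fin n → ℝ) × ℝ → ℝ} (hf : ContDiff ℝ (⊤ : ℕ∞) f)
    (q v : (Fin n → ℝ) × ℝ) (hq : IsLocalMin f q) : 0 ≤ pdE n (pdE n f v) v q := by
  by_contra hneg
  push Not at hneg
  have d1 : deriv (fun s : ℝ => f (q + s • v)) = fun s => pdE n f v (q + s • v) :=
    funext fun s => (line_hasDerivAt n hf q v s).deriv
  have d2 : deriv (deriv (fun s : ℝ => f (q + s • v))) 0 = pdE n (pdE n f v) v q := by
    rw [d1, (line_hasDerivAt n (pdE_contDiff n hf v) q v 0).deriv]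
    simp
  have hc : Continuous (fun s : ℝ => q + s • v) := by fun_prop
  have hmin : IsLocalMin (fun s : ℝ => f (q + s • v)) 0 := by
    have h0 : Filter.Tendsto (fun s : ℝ => q + s • v) (nhds 0) (nhds q) := by
      simpa using hc.tendsto 0
    have := h0.eventually hq
    simpa [IsLocalMin, IsMinFilter] using this
  have hmax := isLocalMax_of_deriv_deriv_neg (f := fun s : ℝ => f (q + s • v)) (x₀ := 0)
    (by rw [d2]; exact hneg) hmin.deriv_eq_zero (hf.continuous.comp hc).continuousAt
  have heq : (fun s : ℝ => f (q + s • v)) =ᶠ[nhds 0] fun _ => f (q + (0:ℝ) • v) := by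
    filter_upwards [hmin, hmax] with s h1 h2
    exact le_antisymm h2 h1
  have h3 : deriv (deriv (fun s : ℝ => f (q + s • v))) 0 = 0 := by
    have := heq.deriv.deriv_eq
    rw [this]; simp
  rw [d2] at h3
  linarith

theorem exists_shift (n : ℕ) (x : Fin n → ℝ) :
    ∃ k : Fin n → ℤ, ∀ i, (x + fun i => (k i : ℝ)) i ∈ Set.Ico (0:ℝ) 1 := by
  refine ⟨fun i => -⌊x i⌋, fun i => ?_⟩
  simp only [Pi.add_apply, Int.cast_neg]
  exact ⟨by linarith [Int.floor_le (x i)], by linarith [Int.lt_floor_add_one (x i)]⟩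

theorem pdE_periodic (n : ℕ) {φ : (Fin n → ℝ) × ℝ → ℝ} (hp : ZPeriodicE n φ)
    (v : (Fin n → ℝ) × ℝ) : ZPeriodicE n (pdE n φ v) := by
  intro x y k
  have h1 : (fun q : (Fin n → ℝ) × ℝ => φ (q + ((fun i => (k i : ℝ)), (0:ℝ)))) = φ := by
    funext q
    have := hp q.1 q.2 k
    simpa [Prod.add_def] using this
  have h2 := fderiv_comp_add_right (𝕜 := ℝ) (f := φ) (x := (x, y)) (((fun i => (k i : ℝ)), (0:ℝ)))
  rw [h1] at h2
  unfold pdE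
  rw [h2]
  simp

theorem lapE_pdE (n : ℕ) {φ : (Fin n → ℝ) × ℝ → ℝ} (hφ : ContDiff ℝ (⊤ : ℕ∞) φ)
    {h : (Fin n → ℝ) → ℝ} (hh : Continuous h)
    (hl : ∀ p : (Fin n → ℝ) × ℝ, p.2 < h p.1 → lapE n φ p = 0)
    (v p : (Fin n → ℝ) × ℝ) (hp : p.2 < h p.1) : lapE n (pdE n φ v) p = 0 := by
  have hev : lapE n φ =ᶠ[nhds p] fun _ => 0 := by
    have : IsOpen {p : (Fin n → ℝ) × ℝ | p.2 < h p.1} :=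
      isOpen_lt continuous_snd (hh.comp continuous_fst)
    filter_upwards [this.mem_nhds hp] with q hq using hl q hq
  have h1 : pdE n (lapE n φ) v p = 0 := by
    unfold pdE
    rw [hev.fderiv_eq]
    simp
  have hd : ∀ w, DifferentiableAt ℝ (pdE n (pdE n φ w) w) p := fun w =>
    (pdE_contDiff n (pdE_contDiff n hφ w) w).differentiable (by simp) p
  have hs : DifferentiableAt ℝ (fun q => ∑ i, pdE n (pdE n φ (eX n i)) (eX n i) q) p :=
    DifferentiableAt.fun_sum fun i _ => hd _
  have h2 : pdE n (lapE n φ) v p = (∑ i, pdE n (pdE n (pdE n φ (eX n i)) (eX n i)) v p)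
      + pdE n (pdE n (pdE n φ (eY n)) (eY n)) v p := by
    have e : lapE n φ = fun q => (∑ i, pdE n (pdE n φ (eX n i)) (eX n i) q) +
      pdE n (pdE n φ (eY n)) (eY n) q := rfl
    rw [e]
    change fderiv ℝ _ p v = _
    rw [fderiv_fun_add hs (hd _), fderiv_fun_sum (fun i _ => hd _)]
    simp [pdE]
  have h3 : ∀ w, pdE n (pdE n (pdE n φ w) w) v p = pdE n (pdE n (pdE n φ v) w) w p := by
    intro w
    rw [pdE_comm n (pdE_contDiff n hφ w)]
    have : pdE n (pdE n φ w) v = pdE n (pdE n φ v) w := funext fun q => pdE_comm n hφ w v q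
    rw [this]
  rw [h1] at h2
  simp only [h3] at h2
  exact h2.symm

/-- Enlarged cell, below height `M`. -/
def bigS (n : ℕ) (M : ℝ) : Set ((Fin n → ℝ) × ℝ) :=
  {p | (∀ i, p.1 i ∈ Set.Icc (-1:ℝ) 2) ∧ p.2 < M}

theorem bigS_meas (n : ℕ) (M : ℝ) : MeasurableSet (bigS n M) := by
  have : bigS n M = (Prod.fst ⁻¹' (Set.univ.pi fun _ => Set.Icc (-1:ℝ) 2)) ∩ (Prod.snd ⁻¹' Set.Iio M) := by
    ext p; simp only [bigS, Set.mem_setOf_eq, Set.mem_inter_iff, Set.mem_preimage, Set.mem_univ_pi, Set.mem_Iio]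
  rw [this]
  exact (measurable_fst (MeasurableSet.univ_pi fun _ => measurableSet_Icc)).inter
    (measurable_snd measurableSet_Iio)

theorem haarE (n : ℕ) : (volume : Measure ((Fin n → ℝ) × ℝ)).IsAddHaarMeasure :=
  Measure.prod.instIsAddHaarMeasure (volume : Measure (Fin n → ℝ)) (volume : Measure ℝ)

theorem bigS_integrable (n : ℕ) {h : (Fin n → ℝ) → ℝ} (hper : ZPeriodic n h)
    {f : (Fin n → ℝ) × ℝ → ℝ} (fper : ZPeriodicE n f)
    (hf : IntegrableOn f (fluidCell n h)) {m : ℝ} (hm : ∀ x, m ≤ h x) :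
    IntegrableOn f (bigS n m) := by
  have := haarE n
  have key : ∀ k : Fin n → ℤ, IntegrableOn f
      ((fun p : (Fin n → ℝ) × ℝ => p + ((fun i => ((-k i : ℤ) : ℝ)), (0:ℝ))) ⁻¹' fluidCell n h) := by
    intro k
    have e : f ∘ (fun p : (Fin n → ℝ) × ℝ => p + ((fun i => ((-k i : ℤ) : ℝ)), (0:ℝ))) = f := by
      funext q
      have := fper q.1 q.2 (fun i => -k i)
      simpa [Prod.add_def] using this
    have := (measurePreserving_add_right (volume : Measure ((Fin n → ℝ) × ℝ))
      ((fun i => ((-k i : ℤ) : ℝ)), (0:ℝ))).integrableOn_comp_preimage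
      (MeasurableEquiv.addRight ((fun i => ((-k i : ℤ) : ℝ)), (0:ℝ))).measurableEmbedding (f := f) (s := fluidCell n h)
    rw [e] at this
    exact this.2 hf
  have hU : IntegrableOn f (⋃ k ∈ Fintype.piFinset (fun _ : Fin n => Finset.Icc (-1:ℤ) 2),
      ((fun p : (Fin n → ℝ) × ℝ => p + ((fun i => ((-k i : ℤ) : ℝ)), (0:ℝ))) ⁻¹' fluidCell n h)) :=
    integrableOn_finset_iUnion.2 fun k _ => key k
  apply hU.mono_set
  intro p hp
  simp only [Set.mem_iUnion]
  refine ⟨fun i => ⌊p.1 i⌋, ?_, ?_, ?_⟩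
  · rw [Fintype.mem_piFinset]
    intro i
    rw [Finset.mem_Icc]
    have := hp.1 i
    constructor
    · rw [Int.le_floor]; simpa using this.1
    · have h1 : (⌊p.1 i⌋ : ℝ) ≤ 2 := (Int.floor_le _).trans this.2
      exact_mod_cast h1
  · intro i _
    simp only [Prod.fst_add, Pi.add_apply, Int.cast_neg]
    exact ⟨by linarith [Int.floor_le (p.1 i)], by linarith [Int.lt_floor_add_one (p.1 i)]⟩
  · have := hper p.1 (fun i => -⌊p.1 i⌋)
    simp only [Prod.fst_add, Prod.snd_add, add_zero]
    rw [this]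
    exact lt_of_lt_of_le hp.2 (hm _)

theorem bigS_tail (n : ℕ) {f : (Fin n → ℝ) × ℝ → ℝ} {m : ℝ} (hf : IntegrableOn f (bigS n m))
    {δ : ℝ} (hδ : 0 < δ) : ∃ M ≤ m, ∫ p in bigS n M, f p < δ := by
  have hanti : Antitone (fun k : ℕ => bigS n (m - k)) := by
    intro a b hab p hp
    refine ⟨hp.1, hp.2.trans_le ?_⟩
    have : (a:ℝ) ≤ b := by exact_mod_cast hab
    linarith
  have hem : (⋂ k : ℕ, bigS n (m - k)) = ∅ := by
    apply Set.eq_empty_of_forall_notMem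
    intro p hp
    rw [Set.mem_iInter] at hp
    obtain ⟨k, hk⟩ := exists_nat_gt (m - p.2)
    have := (hp k).2
    linarith
  have ht := tendsto_setIntegral_of_antitone (μ := volume) (f := f) (fun k : ℕ => bigS_meas n (m - k)) hanti
    ⟨0, by simpa using hf⟩
  rw [hem] at ht
  simp only [Measure.restrict_empty, integral_zero_measure] at ht
  obtain ⟨k, hk⟩ := (ht.eventually (gt_mem_nhds hδ)).exists
  exact ⟨m - k, by simp, hk⟩

theorem decay (n : ℕ) {h : (Fin n → ℝ) → ℝ} (hh : Continuous h) (hper : ZPeriodic n h)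
    {φ : (Fin n → ℝ) × ℝ → ℝ} {ψ : (Fin n → ℝ) → ℝ} (H : IsHarmonicExt n h ψ φ)
    {m : ℝ} (hm : ∀ x, m ≤ h x) :
    ∃ M, ∀ x y, y < M → |pdE n φ (eY n) (x, y)| ≤ 1/2 := by
  have := haarE n
  set f := pdE n φ (eY n) with hfdef
  have fsm : ContDiff ℝ (⊤ : ℕ∞) f := pdE_contDiff n H.smooth _
  have fc := fsm.continuous
  have fper : ZPeriodicE n f := pdE_periodic n H.periodic _
  have f2per : ZPeriodicE n (fun p => (f p)^2) := fun x y k => by simp only [fper x y k]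
  have f2int : IntegrableOn (fun p => (f p)^2) (fluidCell n h) := by
    refine Integrable.mono' H.gradL2 (by fun_prop) (Filter.Eventually.of_forall fun p => ?_)
    rw [Real.norm_of_nonneg (sq_nonneg _)]
    unfold gradSqE
    have : 0 ≤ ∑ i, (pdE n φ (eX n i) p)^2 := by positivity
    linarith
  have hc := ker_int_pos n
  set c := ∫ z, ker n z with hcdef
  have hS := bigS_integrable n hper f2per f2int hm
  obtain ⟨M, hMm, hM⟩ := bigS_tail n hS (δ := c/4) (by positivity)
  have hSM : IntegrableOn (fun p => (f p)^2) (bigS n M) :=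
    hS.mono_set fun p hp => ⟨hp.1, hp.2.trans_le hMm⟩
  have kc := ker_continuous n
  have main : ∀ p : (Fin n → ℝ) × ℝ, (∀ i, p.1 i ∈ Set.Ico (0:ℝ) 1) → p.2 < M - 1 → |f p| ≤ 1/2 := by
    intro p hp1 hp2
    have inS : ∀ z, nsq n z ≤ 1 → p + z ∈ bigS n M := by
      intro z hz
      obtain ⟨h1, h2⟩ := nsq_coord n hz
      refine ⟨fun i => ?_, ?_⟩
      · have a := abs_le.1 (h1 i)
        have b := hp1 i
        simp only [Prod.fst_add, Pi.add_apply]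
        exact ⟨by linarith [b.1], by linarith [b.2]⟩
      · have a := abs_le.1 h2
        simp only [Prod.snd_add]
        linarith
    have hmv := mvp n fsm p (fun z hz => lapE_pdE n H.smooth hh H.harmonic _ _ 
      (lt_of_lt_of_le (inS z hz).2 (hMm.trans (hm _))))
    have i1 : Integrable (fun z => |f (p + z)| * ker n z) :=
      Continuous.integrable_of_hasCompactSupport (by fun_prop) (ker_support n).mul_left
    have i2 : Integrable (fun z => (1/4) * ker n z) :=
      Continuous.integrable_of_hasCompactSupport (by fun_prop) (ker_support n).mul_left
    have i3 : Integrable (fun z => (bigS n M).indicator (fun q => (f q)^2) (p + z)) := 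
      (hSM.integrable_indicator (bigS_meas n M)).comp_add_left p
    have hI : ∫ z, (bigS n M).indicator (fun q => (f q)^2) (p + z) = ∫ q in bigS n M, (f q)^2 := by
      rw [integral_add_left_eq_self (fun z => (bigS n M).indicator (fun q => (f q)^2) z) p,
        integral_indicator (bigS_meas n M)]
    have b1 : |f p| * c ≤ ∫ z, |f (p + z)| * ker n z := by
      have : |f p| * c = |∫ z, f (p + z) * ker n z| := by
        rw [hmv, abs_mul, abs_of_pos hc]
      rw [this]
      refine (abs_integral_le_integral_abs).trans (le_of_eq ?_)
      congr 1
      funext z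
      rw [abs_mul, abs_of_nonneg (ker_nonneg n z)]
    have b2 : ∫ z, |f (p + z)| * ker n z ≤ 
        ∫ z, ((1/4) * ker n z + (bigS n M).indicator (fun q => (f q)^2) (p + z)) := by
      apply integral_mono i1 (i2.add i3)
      intro z
      simp only [Pi.add_apply]
      by_cases hz : nsq n z ≤ 1
      · rw [Set.indicator_of_mem (inS z hz)]
        have k0 := ker_nonneg n z
        have k1 := ker_le_one n z
        have a1 : |f (p+z)| ≤ 1/4 + (f (p+z))^2 := by
          rw [← sq_abs]; nlinarith [sq_nonneg (|f (p+z)| - 1/2)]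
        nlinarith [mul_le_mul_of_nonneg_right a1 k0, mul_le_mul_of_nonneg_left k1 (sq_nonneg (f (p+z)))]
      · rw [ker_zero n (not_le.1 hz)]
        simp only [mul_zero, zero_add]
        exact Set.indicator_nonneg (fun q _ => sq_nonneg _) _
    rw [integral_add i2 i3, hI, integral_const_mul, ← hcdef] at b2
    have : |f p| * c ≤ (1/2) * c := by linarith
    exact le_of_mul_le_mul_right this hc
  refine ⟨M - 1, fun x y hy => ?_⟩
  obtain ⟨k, hk⟩ := exists_shift n x
  rw [← fper x y k]
  exact main _ hk hy

theorem isCompact_cube (n : ℕ) : IsCompact (Set.Icc (0 : Fin n → ℝ) 1) := isCompact_Icc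

theorem shift_cube (n : ℕ) (x : Fin n → ℝ) :
    ∃ k : Fin n → ℤ, (x + fun i => (k i : ℝ)) ∈ Set.Icc (0 : Fin n → ℝ) 1 := by
  obtain ⟨k, hk⟩ := exists_shift n x
  exact ⟨k, fun i => (hk i).1, fun i => (hk i).2.le⟩

theorem periodic_bddBelow (n : ℕ) {g : (Fin n → ℝ) → ℝ} (hg : Continuous g) (hp : ZPeriodic n g) :
    ∃ x₀, ∀ x, g x₀ ≤ g x := by
  obtain ⟨x₀, _, h0⟩ := (isCompact_cube n).exists_isMinOn ⟨0, by simp⟩ hg.continuousOn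
  refine ⟨x₀, fun x => ?_⟩
  obtain ⟨k, hk⟩ := shift_cube n x
  rw [← hp x k]
  exact h0 hk

theorem deep_positive (n : ℕ) {h : (Fin n → ℝ) → ℝ} (hh : Continuous h) (hper : ZPeriodic n h)
    {φ : (Fin n → ℝ) × ℝ → ℝ} {ψ : (Fin n → ℝ) → ℝ} (H : IsHarmonicExt n h ψ φ) :
    ∃ Y, ∀ x y, y < Y → y < φ (x, y) := by
  obtain ⟨x0, hx0⟩ := periodic_bddBelow n hh hper
  obtain ⟨M, hM⟩ := decay n hh hper H hx0
  have hφc := H.smooth.continuous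
  obtain ⟨x1, hx1⟩ := periodic_bddBelow n (g := fun x => φ (x, M - 1)) (by fun_prop) 
    (fun x k => H.periodic x _ k)
  set C := φ (x1, M - 1)
  refine ⟨min (M - 1) (2 * C - (M - 1)), fun x y hy => ?_⟩
  have hy1 : y < M - 1 := hy.trans_le (min_le_left _ _)
  have hy2 : y < 2 * C - (M - 1) := hy.trans_le (min_le_right _ _)
  have hd : ∀ s, HasDerivAt (fun s => φ (x, s) - s / 2) (pdE n φ (eY n) (x, s) - 1/2) s := by
    intro s
    have := line_hasDerivAt n H.smooth (x, 0) (eY n) s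
    simp only [eY, Prod.smul_mk, smul_zero, smul_eq_mul, mul_one, Prod.mk_add_mk, add_zero, zero_add] at this
    exact this.sub ((hasDerivAt_id s).div_const 2)
  have ha : AntitoneOn (fun s => φ (x, s) - s / 2) (Set.Iic (M - 1)) := by
    apply antitoneOn_of_deriv_nonpos (convex_Iic _)
    · exact fun s _ => (hd s).continuousAt.continuousWithinAt
    · exact fun s _ => (hd s).differentiableAt.differentiableWithinAt
    · intro s hs
      rw [interior_Iic] at hs
      rw [(hd s).deriv]
      have := (abs_le.1 (hM x s (by have : s < M - 1 := hs; linarith))).2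
      linarith
  have h1 := ha (show y ∈ Set.Iic (M-1) from hy1.le) (show M - 1 ∈ Set.Iic (M-1) from Set.mem_Iic.2 le_rfl) hy1.le
  have h2 := hx1 x
  simp only at h1 h2
  linarith

theorem barrier_pd (n : ℕ) {φ g : (Fin n → ℝ) × ℝ → ℝ} (hφ : ContDiff ℝ (⊤ : ℕ∞) φ)
    (hg : ContDiff ℝ (⊤ : ℕ∞) g) (α ε : ℝ) (w : (Fin n → ℝ) × ℝ) :
    pdE n (fun p => φ p - p.2 - ε * (Real.exp (α * g p) - 1)) w =
      fun p => pdE n φ w p - w.2 - ε * (Real.exp (α * g p) * (α * pdE n g w p)) := by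
  funext p
  have h1 := ((hφ.differentiable (by simp)) p).hasFDerivAt
  have h2 := ((hg.differentiable (by simp)) p).hasFDerivAt
  have h3 : HasFDerivAt (fun p : (Fin n → ℝ) × ℝ => p.2) (ContinuousLinearMap.snd ℝ (Fin n → ℝ) ℝ) p :=
    (ContinuousLinearMap.snd ℝ (Fin n → ℝ) ℝ).hasFDerivAt
  have h4 := (h1.sub h3).sub ((((h2.const_mul α).exp).sub_const 1).const_mul ε)
  have h5 : HasFDerivAt (fun p => φ p - p.2 - ε * (Real.exp (α * g p) - 1)) _ p := h4
  unfold pdE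
  rw [h5.fderiv]
  simp

theorem barrier_pd2 (n : ℕ) {φ g : (Fin n → ℝ) × ℝ → ℝ} (hφ : ContDiff ℝ (⊤ : ℕ∞) φ)
    (hg : ContDiff ℝ (⊤ : ℕ∞) g) (α ε : ℝ) (w q : (Fin n → ℝ) × ℝ) :
    pdE n (pdE n (fun p => φ p - p.2 - ε * (Real.exp (α * g p) - 1)) w) w q =
      pdE n (pdE n φ w) w q - ε * (α * Real.exp (α * g q) * 
        (α * (pdE n g w q)^2 + pdE n (pdE n g w) w q)) := by
  rw [barrier_pd n hφ hg]
  have h1 := (((pdE_contDiff n hφ w).differentiable (by simp)) q).hasFDerivAt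
  have h2 := ((hg.differentiable (by simp)) q).hasFDerivAt
  have h3 := (((pdE_contDiff n hg w).differentiable (by simp)) q).hasFDerivAt
  have h4 := (h1.sub_const w.2).sub (((h2.const_mul α).exp.mul (h3.const_mul α)).const_mul ε)
  have h5 : HasFDerivAt (fun p => pdE n φ w p - w.2 - ε * (Real.exp (α * g p) * (α * pdE n g w p)))
    _ q := h4
  conv_lhs => rw [pdE, h5.fderiv]
  simp only [ContinuousLinearMap.sub_apply, ContinuousLinearMap.smul_apply, 
    ContinuousLinearMap.add_apply, smul_eq_mul]
  change pdE n (pdE n φ w) w q - ε * (Real.exp (α * g q) * (α * pdE n (pdE n g w) w q) + 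
    α * pdE n g w q * (Real.exp (α * g q) * (α * pdE n g w q))) = _
  ring

theorem barrier_lap (n : ℕ) {φ g : (Fin n → ℝ) × ℝ → ℝ} (hφ : ContDiff ℝ (⊤ : ℕ∞) φ)
    (hg : ContDiff ℝ (⊤ : ℕ∞) g) (α ε : ℝ) (q : (Fin n → ℝ) × ℝ) :
    lapE n (fun p => φ p - p.2 - ε * (Real.exp (α * g p) - 1)) q =
      lapE n φ q - ε * (α * Real.exp (α * g q) * (α * gradSqE n g q + lapE n g q)) := by
  unfold lapE gradSqE
  simp only [barrier_pd2 n hφ hg, Finset.sum_sub_distrib, ← Finset.mul_sum, Finset.sum_add_distrib]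
  ring

theorem rt_pos (n : ℕ) {h : (Fin n → ℝ) → ℝ} (hh : ContDiff ℝ (⊤ : ℕ∞) h) (hper : ZPeriodic n h)
    {φ : (Fin n → ℝ) × ℝ → ℝ} (H : IsHarmonicExt n h h φ) (x : Fin n → ℝ) :
    pdE n φ (eY n) (x, h x) < 1 := by
  have hhc := hh.continuous
  have hφc := H.smooth.continuous
  obtain ⟨Y, hY⟩ := deep_positive n hhc hper H
  obtain ⟨xm, hxm⟩ := periodic_bddBelow n (g := fun x => - h x) hhc.neg 
    (fun x k => by simp only [hper x k])
  -- depth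
  obtain ⟨D, hD0, hD⟩ : ∃ D > 0, ∀ x, h x - D < Y := by
    refine ⟨max 1 (h xm - Y + 1), by positivity, fun x => ?_⟩
    have h1 := hxm x
    have h2 := le_max_right 1 (h xm - Y + 1)
    linarith
  -- minimum of u at depth D
  obtain ⟨x1, hx1⟩ := periodic_bddBelow n (g := fun x => φ (x, h x - D) - (h x - D)) (by fun_prop)
    (fun x k => by simp only [hper x k, H.periodic x _ k])
  set u0 := φ (x1, h x1 - D) - (h x1 - D) with hu0
  have hu0pos : 0 < u0 := sub_pos.2 (hY _ _ (hD x1))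
  let g : (Fin n → ℝ) × ℝ → ℝ := fun p => h p.1 - p.2
  have hg : ContDiff ℝ (⊤ : ℕ∞) g := (hh.comp contDiff_fst).sub contDiff_snd
  have gY : ∀ p, pdE n g (eY n) p = -1 := by
    intro p
    have h1 : HasFDerivAt (fun p : (Fin n → ℝ) × ℝ => p.2) (ContinuousLinearMap.snd ℝ (Fin n → ℝ) ℝ) p :=
      (ContinuousLinearMap.snd ℝ (Fin n → ℝ) ℝ).hasFDerivAt
    have h2 : HasFDerivAt (fun p : (Fin n → ℝ) × ℝ => h p.1) _ p :=
      ((hh.differentiable (by simp)) p.1).hasFDerivAt.comp p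
        (ContinuousLinearMap.fst ℝ (Fin n → ℝ) ℝ).hasFDerivAt
    have h3 : HasFDerivAt g _ p := h2.sub h1
    unfold pdE
    rw [h3.fderiv]
    simp [eY]
  have glap : Continuous (lapE n g) := by
    have : ∀ v, Continuous (pdE n (pdE n g v) v) := fun v => 
      (pdE_contDiff n (pdE_contDiff n hg v) v).continuous
    unfold lapE
    exact (continuous_finset_sum _ fun i _ => this _).add (this _)
  let Φ : (Fin n → ℝ) × ℝ → (Fin n → ℝ) × ℝ := fun p => (p.1, h p.1 - p.2)
  have hΦ : Continuous Φ := by fun_prop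
  let K := Φ '' (Set.Icc (0 : Fin n → ℝ) 1 ×ˢ Set.Icc 0 D)
  have hK : IsCompact K := ((isCompact_cube n).prod isCompact_Icc).image hΦ
  have hKne : K.Nonempty := 
    ⟨Φ (0, 0), (0, 0), ⟨by simp, by simp [hD0.le]⟩, rfl⟩
  obtain ⟨C, hC⟩ := hK.exists_bound_of_continuousOn glap.continuousOn
  have hC0 : 0 ≤ C := by
    obtain ⟨q, hq⟩ := hKne
    exact (norm_nonneg _).trans (hC q hq)
  set α := C + 1 with hα
  have hα0 : 0 < α := by positivity
  set ε := u0 / Real.exp (α * D) with hε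
  have hε0 : 0 < ε := div_pos hu0pos (Real.exp_pos _)
  set v : (Fin n → ℝ) × ℝ → ℝ := fun p => φ p - p.2 - ε * (Real.exp (α * g p) - 1) with hv
  have hvs : ContDiff ℝ (⊤ : ℕ∞) v := by
    have := H.smooth
    have e : ContDiff ℝ (⊤ : ℕ∞) (fun p => Real.exp (α * g p)) := (contDiff_const.mul hg).exp
    exact (this.sub contDiff_snd).sub (contDiff_const.mul (e.sub contDiff_const))
  have vper : ZPeriodicE n v := by
    intro x y k
    simp only [hv, g, H.periodic x y k, hper x k]
  have vtop : ∀ x, v (x, h x) = 0 := by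
    intro x
    simp [hv, g, H.boundary x]
  have vbot : ∀ x, 0 < v (x, h x - D) := by
    intro x
    have h1 := hx1 x
    have h2 : ε * Real.exp (α * D) = u0 := div_mul_cancel₀ _ (Real.exp_pos _).ne'
    simp only [hv, g, sub_sub_cancel]
    linarith
  obtain ⟨q, hqK, hq⟩ := hK.exists_isMinOn hKne hvs.continuous.continuousOn
  have hqall : ∀ p : (Fin n → ℝ) × ℝ, h p.1 - D ≤ p.2 → p.2 ≤ h p.1 → v q ≤ v p := by
    rintro ⟨x, y⟩ h1 h2
    obtain ⟨k, hk⟩ := shift_cube n x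
    rw [← vper x y k]
    apply hq
    refine ⟨(x + fun i => (k i : ℝ), h x - y), ⟨hk, ?_⟩, ?_⟩
    · simp only at h1 h2
      exact ⟨by simp only; linarith, by simp only; linarith⟩
    · simp only [Φ, hper x k, sub_sub_cancel]
  have hq0 : 0 ≤ v q := by
    by_contra hneg
    push Not at hneg
    obtain ⟨⟨a, d⟩, ⟨ha, hd⟩, hΦq⟩ := hqK
    have hqe : q = (a, h a - d) := hΦq.symm
    have hdpos : 0 < d := by
      rcases hd.1.lt_or_eq with h1 | h1
      · exact h1
      · exfalso
        have h1' : (0:ℝ) = d := h1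
        rw [hqe, ← h1', sub_zero, vtop] at hneg
        exact lt_irrefl _ hneg
    have hdlt : d < D := by
      rcases hd.2.lt_or_eq with h1 | h1
      · exact h1
      · exfalso
        have h1' : d = D := h1
        rw [hqe, h1'] at hneg
        exact lt_asymm hneg (vbot a)
    have hloc : IsLocalMin v q := by
      have o1 : IsOpen {p : (Fin n → ℝ) × ℝ | p.2 < h p.1} :=
        isOpen_lt continuous_snd (hhc.comp continuous_fst)
      have o2 : IsOpen {p : (Fin n → ℝ) × ℝ | h p.1 - D < p.2} :=
        isOpen_lt (by fun_prop) continuous_snd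
      have m1 : q ∈ {p : (Fin n → ℝ) × ℝ | p.2 < h p.1} := by
        rw [hqe]; change h a - d < h a; linarith
      have m2 : q ∈ {p : (Fin n → ℝ) × ℝ | h p.1 - D < p.2} := by
        rw [hqe]; change h a - D < h a - d; linarith
      filter_upwards [o1.mem_nhds m1, o2.mem_nhds m2] with p p1 p2
      exact hqall p (le_of_lt p2) (le_of_lt p1)
    have hlap : 0 ≤ lapE n v q := by
      unfold lapE
      exact add_nonneg (Finset.sum_nonneg fun i _ => snd_nonneg_of_localMin n hvs q _ hloc)
        (snd_nonneg_of_localMin n hvs q _ hloc)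
    rw [hv, barrier_lap n H.smooth hg, H.harmonic q (by rw [hqe]; change h a - d < h a; linarith)] at hlap
    have hb : |lapE n g q| ≤ C := hC q ⟨(a, d), ⟨ha, hd⟩, hΦq⟩
    have hgr : 1 ≤ gradSqE n g q := by
      unfold gradSqE
      rw [gY]
      have : 0 ≤ ∑ i, (pdE n g (eX n i) q)^2 := by positivity
      linarith
    have hpos : 0 < α * gradSqE n g q + lapE n g q := by
      have := (abs_le.1 hb).1
      nlinarith
    have : 0 < ε * (α * Real.exp (α * g q) * (α * gradSqE n g q + lapE n g q)) := by
      have := Real.exp_pos (α * g q)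
      positivity
    linarith
  -- derivative at the boundary
  have hvd : pdE n v (eY n) (x, h x) = pdE n φ (eY n) (x, h x) - 1 + ε * α := by
    rw [hv, barrier_pd n H.smooth hg]
    simp only [gY]
    simp [eY, g]
  have hder := line_hasDerivAt n hvs (x, h x) (eY n) 0
  have hle : pdE n v (eY n) (x, h x) ≤ 0 := by
    rw [zero_smul, add_zero] at hder
    by_contra hc
    push Not at hc
    have hs := hder.hasDerivWithinAt (s := Set.Iio 0)
    have ht := (hasDerivWithinAt_iff_tendsto_slope' (by simp)).1 hs
    have hev : ∀ᶠ s in nhdsWithin (0:ℝ) (Set.Iio 0), 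
        slope (fun s : ℝ => v ((x, h x) + s • eY n)) 0 s ≤ 0 := by
      have : Set.Ioo (-D) 0 ∈ nhdsWithin (0:ℝ) (Set.Iio 0) := Ioo_mem_nhdsLT (by linarith)
      filter_upwards [this] with s hs
      have h1 : 0 ≤ v ((x, h x) + s • eY n) := by
        refine hq0.trans (hqall _ ?_ ?_)
        · simp [eY]; linarith [hs.1]
        · simp [eY]; linarith [hs.2]
      rw [slope_def_field]
      simp only [zero_smul, add_zero, vtop, sub_zero]
      exact div_nonpos_of_nonneg_of_nonpos h1 hs.2.le
    exact absurd (le_of_tendsto ht hev) (not_le.2 hc)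
  rw [hvd] at hle
  have : 0 < ε * α := by positivity
  linarith

/-- the Rayleigh–Taylor coefficient a = 1 − B of a smooth Hele-Shaw
solution is strictly positive everywhere on [0,T] × 𝕋ⁿ. -/
theorem heleShaw_taylor_positive (n : ℕ) (hn : 1 ≤ n) (T : ℝ) (hT : 0 ≤ T)
    (h : ℝ → (Fin n → ℝ) → ℝ) (hsol : IsHeleShawSol n T h) :
    ∀ t ∈ Set.Icc 0 T, ∀ x, 0 < HSa n h t x := by
  intro t ht x
  have H := hsol.extension t ht
  have hsm : ContDiff ℝ (⊤ : ℕ∞) (h t) := by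
    have : h t = Function.uncurry h ∘ fun x => (t, x) := rfl
    rw [this]
    exact hsol.smooth.comp (contDiff_const.prodMk contDiff_id)
  have key := rt_pos n hsm (hsol.periodic t) H.choose_spec x
  unfold HSa HSB Bop
  rw [dif_pos H]
  linarith

end
end

section
/- Let h : 𝕋ⁿ → ℝ be smooth and let Φ : ℝ → ℝ be a C² convex function. Then ∫_{𝕋ⁿ} Φ'(h(x))·(G(h)h)(x) dx ≥ 0. -/
open MeasureTheory
open scoped Classical

noncomputable section

theorem aux_cell_ae (n : ℕ) :
    cell n =ᵐ[volume] Set.Icc (0 : Fin n → ℝ) 1 := by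
  unfold cell
  exact Measure.univ_pi_Ico_ae_eq_Icc (f := (0 : Fin n → ℝ)) (g := 1)

theorem aux_cell_meas (n : ℕ) : MeasurableSet (cell n) :=
  MeasurableSet.univ_pi fun _ => measurableSet_Ico

theorem aux_cell_vol (n : ℕ) : volume (cell n) = 1 := by
  unfold cell
  rw [Real.volume_pi_Ico]; simp

theorem aux_cell_sub (n : ℕ) : cell n ⊆ Set.Icc (0 : Fin n → ℝ) 1 := by
  intro x hx
  exact ⟨fun i => (hx i trivial).1, fun i => (hx i trivial).2.le⟩

theorem aux_int (n : ℕ) {f : (Fin n → ℝ) → ℝ} (hf : Continuous f) :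
    IntegrableOn f (cell n) :=
  (hf.continuousOn.integrableOn_compact isCompact_Icc).mono_set (aux_cell_sub n)

/-- The integral over a periodic cell of a periodic divergence vanishes. -/
theorem aux_div (n : ℕ) (hn : 1 ≤ n) (W : Fin n → (Fin n → ℝ) → ℝ)
    (hW : ∀ i, ContDiff ℝ 1 (W i)) (hp : ∀ i, ZPeriodic n (W i)) :
    ∫ x in cell n, ∑ i, pdX n (W i) i x = 0 := by
  obtain ⟨m, rfl⟩ : ∃ m, n = m + 1 := ⟨n - 1, by omega⟩
  rw [setIntegral_congr_set (aux_cell_ae (m + 1))]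
  have hc : Continuous fun x => ∑ i, pdX (m+1) (W i) i x := by
    unfold pdX
    refine continuous_finsetSum _ fun i _ => ?_
    exact ((hW i).continuous_fderiv (by norm_num)).clm_apply continuous_const
  have key := integral_divergence_of_hasFDerivAt_off_countable
    (0 : Fin (m+1) → ℝ) 1 zero_le_one (fun x i => W i x)
    (fun x => ContinuousLinearMap.pi fun i => fderiv ℝ (W i) x) ∅ Set.countable_empty
    (continuous_pi fun i => (hW i).continuous).continuousOn
    (by
      intro x _
      rw [hasFDerivAt_pi]
      intro i
      exact ((hW i).differentiable (by norm_num) x).hasFDerivAt)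
    (by
      simpa [pdX] using hc.continuousOn.integrableOn_compact isCompact_Icc)
  simp only [ContinuousLinearMap.coe_pi'] at key
  unfold pdX
  rw [key]
  refine Finset.sum_eq_zero fun i _ => ?_
  rw [sub_eq_zero]
  congr 1
  funext x
  have := hp i (i.insertNth ((0 : Fin (m+1) → ℝ) i) x) (Pi.single i 1)
  rw [← this]
  congr 1
  funext j
  refine Fin.succAboveCases i ?_ (fun j => ?_) j
  · simp
  · simp

/-- Flux monotonicity in shifted levels. -/
theorem aux_flux (n : ℕ) (hn : 1 ≤ n) (h : (Fin n → ℝ) → ℝ)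
    (hh : ContDiff ℝ (⊤ : ℕ∞) h) (hhper : ZPeriodic n h)
    (A : Fin n → (Fin n → ℝ) × ℝ → ℝ) (B : (Fin n → ℝ) × ℝ → ℝ)
    (hA : ∀ i, ContDiff ℝ 1 (A i)) (hB : ContDiff ℝ 1 B) (hAp : ∀ i, ZPeriodicE n (A i))
    (hdiv : ∀ p : (Fin n → ℝ) × ℝ, p.2 < h p.1 →
      0 ≤ (∑ i, pdE n (A i) (eX n i) p) + pdE n B (eY n) p)
    (a : ℝ) (ha : a ≤ 0) :
    ∫ x in cell n, (B (x, h x + a) - ∑ i, pdX n h i x * A i (x, h x + a)) ≤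
    ∫ x in cell n, (B (x, h x) - ∑ i, pdX n h i x * A i (x, h x)) := by
  have hhc : Continuous h := hh.continuous
  have hpdh : ∀ i, Continuous (pdX n h i) := fun i => by
    unfold pdX
    exact (hh.continuous_fderiv (by simp)).clm_apply continuous_const
  have hpdE : ∀ {f : (Fin n → ℝ) × ℝ → ℝ}, ContDiff ℝ 1 f → ∀ v, Continuous (pdE n f v) :=
    fun hf v => by
      unfold pdE
      exact (hf.continuous_fderiv (by norm_num)).clm_apply continuous_const
  have hline : ∀ {f : (Fin n → ℝ) × ℝ → ℝ}, ContDiff ℝ 1 f → ∀ x z,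
      HasDerivAt (fun z => f (x, h x + z)) (pdE n f (eY n) (x, h x + z)) z := by
    intro f hf x z
    have h1 : HasDerivAt (fun z : ℝ => (x, h x + z)) ((0 : Fin n → ℝ), (1 : ℝ)) z :=
      (hasDerivAt_const z x).prodMk ((hasDerivAt_id z).const_add (h x))
    exact ((hf.differentiable (by norm_num) (x, h x + z)).hasFDerivAt).comp_hasDerivAt z h1
  set D : ℝ → (Fin n → ℝ) → ℝ := fun z x =>
    pdE n B (eY n) (x, h x + z) - ∑ i, pdX n h i x * pdE n (A i) (eY n) (x, h x + z) with hD
  have hDc : Continuous (Function.uncurry D) := by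
    have hq : Continuous fun p : ℝ × (Fin n → ℝ) => (p.2, h p.2 + p.1) := by fun_prop
    refine ((hpdE hB _).comp hq).sub (continuous_finsetSum _ fun i _ => ?_)
    exact ((hpdh i).comp continuous_snd).mul ((hpdE (hA i) _).comp hq)
  have hA0 : ∀ i, Continuous (A i) := fun i => (hA i).continuous
  have hB0 := hB.continuous
  have hNc : ∀ z, Continuous fun x => B (x, h x + z) - ∑ i, pdX n h i x * A i (x, h x + z) := by
    intro z; fun_prop
  have hFTC : ∀ x, ∫ z in a..0, D z x =
      (B (x, h x) - ∑ i, pdX n h i x * A i (x, h x)) -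
      (B (x, h x + a) - ∑ i, pdX n h i x * A i (x, h x + a)) := by
    intro x
    have := intervalIntegral.integral_eq_sub_of_hasDerivAt (a := a) (b := 0)
      (f := fun z => B (x, h x + z) - ∑ i, pdX n h i x * A i (x, h x + z))
      (f' := fun z => D z x)
      (fun z _ => (hline hB x z).sub
        (HasDerivAt.fun_sum fun i _ => (hline (hA i) x z).const_mul _))
      ((hDc.comp (by fun_prop : Continuous fun z : ℝ => (z, x))).intervalIntegrable _ _)
    simpa using this
  have hswap := intervalIntegral_integral_swap (μ := volume.restrict (cell n))
    (a := a) (b := 0) (f := D) (by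
      rw [Measure.prod_restrict]
      refine IntegrableOn.mono_set
        (t := Set.Icc a 0 ×ˢ Set.Icc (0 : Fin n → ℝ) 1) ?_ ?_
      · exact hDc.continuousOn.integrableOn_compact (isCompact_Icc.prod isCompact_Icc)
      · refine Set.prod_mono ?_ (aux_cell_sub n)
        rw [Set.uIoc_of_le ha]; exact Set.Ioc_subset_Icc_self)
  simp_rw [hFTC] at hswap
  have hN0 : Continuous fun x => B (x, h x) - ∑ i, pdX n h i x * A i (x, h x) := by fun_prop
  rw [integral_sub (aux_int n hN0) (aux_int n (hNc a))] at hswap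
  have hpos : 0 ≤ ∫ z in a..0, ∫ x in cell n, D z x := by
    rw [intervalIntegral.integral_of_le ha, integral_Ioc_eq_integral_Ioo]
    refine setIntegral_nonneg measurableSet_Ioo fun z hz => ?_
    have hq1 : ContDiff ℝ 1 fun x : Fin n → ℝ => (x, h x + z) :=
      contDiff_id.prodMk ((hh.of_le (by simp)).add contDiff_const)
    have hW : ∀ i, ContDiff ℝ 1 fun x => A i (x, h x + z) := fun i => (hA i).comp hq1
    have hz0 := aux_div n hn (fun i x => A i (x, h x + z)) hW (by
      intro i x k
      simp only [hhper x k]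
      exact hAp i _ _ k)
    have hpd : ∀ i x, pdX n (fun x => A i (x, h x + z)) i x =
        pdE n (A i) (eX n i) (x, h x + z) +
          pdX n h i x * pdE n (A i) (eY n) (x, h x + z) := by
      intro i x
      have hd : HasFDerivAt (fun x : Fin n → ℝ => (x, h x + z))
          ((ContinuousLinearMap.id ℝ (Fin n → ℝ)).prod (fderiv ℝ h x)) x :=
        (hasFDerivAt_id x).prodMk
          (((hh.differentiable (by simp) x).hasFDerivAt).add_const z)
      have := (((hA i).differentiable (by norm_num) (x, h x + z)).hasFDerivAt).comp x hd
      have h2 : fderiv ℝ (fun x => A i (x, h x + z)) x = _ := this.fderiv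
      unfold pdX pdE eX eY
      rw [h2]
      simp only [ContinuousLinearMap.comp_apply, ContinuousLinearMap.prod_apply,
        ContinuousLinearMap.id_apply]
      rw [← smul_eq_mul, ← map_smul, ← map_add]
      simp
    have hcW : Continuous fun x => ∑ i, pdX n (fun x => A i (x, h x + z)) i x := by
      unfold pdX
      refine continuous_finsetSum _ fun i _ => ?_
      exact ((hW i).continuous_fderiv (by norm_num)).clm_apply continuous_const
    have hDz : Continuous fun x => D z x := hDc.comp (by fun_prop : Continuous fun x => (z, x))
    have : ∫ x in cell n, D z x =
        ∫ x in cell n, (D z x + ∑ i, pdX n (fun x => A i (x, h x + z)) i x) := by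
      rw [integral_add (aux_int n hDz) (aux_int n hcW), hz0, add_zero]
    rw [this]
    refine setIntegral_nonneg (aux_cell_meas n) fun x _ => ?_
    have := hdiv (x, h x + z) (by simpa using hz.2)
    simp only [hD, hpd, Finset.sum_add_distrib]
    linarith
  linarith

/-- A bounded C¹ monotone function agreeing with Φ' on [-r,r]. -/
theorem aux_trunc (Φ : ℝ → ℝ) (hΦC2 : ContDiff ℝ 2 Φ) (hΦconv : ConvexOn ℝ Set.univ Φ)
    (r : ℝ) : ∃ g : ℝ → ℝ, ContDiff ℝ 1 g ∧ (∀ s, 0 ≤ deriv g s) ∧ (∃ K, ∀ s, |g s| ≤ K) ∧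
      ∀ s, |s| ≤ r → g s = deriv Φ s := by
  have hd1 : ContDiff ℝ 1 (deriv Φ) := by
    have : ContDiff ℝ (1 + 1) Φ := by simpa [one_add_one_eq_two] using hΦC2
    exact (contDiff_succ_iff_deriv.1 this).2.2
  have hmono : Monotone (deriv Φ) := by
    rw [← monotoneOn_univ]
    exact hΦconv.monotoneOn_deriv fun x _ => hΦC2.differentiable (by norm_num) x
  have hc2 : Continuous (deriv (deriv Φ)) := hd1.continuous_deriv (by norm_num)
  set χ : ℝ → ℝ := fun s => max 0 (min 1 (r + 1 - |s|)) with hχ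
  have hχc : Continuous χ := by fun_prop
  set k : ℝ → ℝ := fun s => deriv (deriv Φ) s * χ s with hk
  have hkc : Continuous k := hc2.mul hχc
  have hk0 : ∀ s, 0 ≤ k s := fun s => mul_nonneg hmono.deriv_nonneg (le_max_left _ _)
  have hks : HasCompactSupport k := by
    refine HasCompactSupport.intro (isCompact_Icc (a := -(r+1)) (b := r+1)) fun s hs => ?_
    have : r + 1 < |s| := by
      by_contra hcon
      exact hs (abs_le.1 (not_lt.1 hcon))
    have : χ s = 0 := max_eq_left ((min_le_right _ _).trans (by linarith))
    simp [hk, this]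
  have hki : Integrable k := hkc.integrable_of_hasCompactSupport hks
  have hder : ∀ s, HasDerivAt (fun u => deriv Φ 0 + ∫ t in (0:ℝ)..u, k t) (k s) s := fun s =>
    (intervalIntegral.integral_hasDerivAt_right (hkc.intervalIntegrable _ _)
      (hkc.stronglyMeasurableAtFilter _ _) hkc.continuousAt).const_add _
  refine ⟨fun u => deriv Φ 0 + ∫ t in (0:ℝ)..u, k t, ?_, ?_, ?_, ?_⟩
  · rw [contDiff_one_iff_deriv]
    refine ⟨fun s => (hder s).differentiableAt, ?_⟩
    rw [funext fun s => (hder s).deriv]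
    exact hkc
  · intro s; rw [(hder s).deriv]; exact hk0 s
  · refine ⟨|deriv Φ 0| + ∫ t, ‖k t‖, fun s => (abs_add_le _ _).trans ?_⟩
    gcongr
    have h1 : ‖∫ t in (0:ℝ)..s, k t‖ ≤ ∫ t in Set.uIoc 0 s, ‖k t‖ :=
      intervalIntegral.norm_integral_le_integral_norm_uIoc
    refine le_trans h1 ?_
    exact setIntegral_le_integral hki.norm (Filter.Eventually.of_forall fun t => norm_nonneg _)
  · intro s hs
    have h1 : ∫ t in (0:ℝ)..s, k t = ∫ t in (0:ℝ)..s, deriv (deriv Φ) t := by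
      refine intervalIntegral.integral_congr fun t ht => ?_
      have hts : |t| ≤ |s| := by
        have := Set.abs_sub_left_of_mem_uIcc ht
        simpa using this
      have : χ t = 1 := by
        simp only [hχ]
        rw [min_eq_left (by linarith)]; simp
      simp [hk, this]
    have h2 : ∫ t in (0:ℝ)..s, deriv (deriv Φ) t = deriv Φ s - deriv Φ 0 :=
      intervalIntegral.integral_deriv_eq_sub' (deriv Φ) rfl
        (fun t _ => hd1.differentiable (by norm_num) t) hc2.continuousOn
    simp only [h1, h2]; ring

/-- Integrability of the level-wise Dirichlet energy. -/
theorem aux_shear (n : ℕ) (h : (Fin n → ℝ) → ℝ) (hh : Continuous h)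
    (f : (Fin n → ℝ) × ℝ → ℝ) (hf : IntegrableOn f (fluidCell n h)) :
    IntegrableOn (fun z => ∫ x in cell n, f (x, h x + z)) (Set.Iio 0) := by
  let e : (Fin n → ℝ) × ℝ ≃ₜ (Fin n → ℝ) × ℝ :=
    { toFun := fun p => (p.1, h p.1 + p.2)
      invFun := fun p => (p.1, p.2 - h p.1)
      left_inv := fun p => by simp
      right_inv := fun p => by simp
      continuous_toFun := by fun_prop
      continuous_invFun := by fun_prop }
  have hmp : MeasurePreserving (fun p : (Fin n → ℝ) × ℝ => (p.1, h p.1 + p.2)) := by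
    have := MeasurePreserving.skew_product (μa := (volume : Measure (Fin n → ℝ)))
      (μc := (volume : Measure ℝ)) (μd := (volume : Measure ℝ))
      (MeasurePreserving.id volume) (g := fun x z => h x + z)
      (by exact Continuous.measurable (by unfold Function.uncurry; fun_prop))
      (Filter.Eventually.of_forall fun x => map_add_left_eq_self volume (h x))
    exact this
  have hemb : MeasurableEmbedding (fun p : (Fin n → ℝ) × ℝ => (p.1, h p.1 + p.2)) :=
    e.measurableEmbedding
  have h1 := (hmp.integrableOn_comp_preimage hemb).2 hf
  have hset : (fun p : (Fin n → ℝ) × ℝ => (p.1, h p.1 + p.2)) ⁻¹' (fluidCell n h) =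
      cell n ×ˢ Set.Iio 0 := by
    ext p; simp [fluidCell]
  rw [hset] at h1
  unfold IntegrableOn at h1
  rw [Measure.volume_eq_prod, ← Measure.prod_restrict] at h1
  exact h1.integral_prod_right

theorem aux_main (n : ℕ) (hn : 1 ≤ n) (h : (Fin n → ℝ) → ℝ)
    (hh : ContDiff ℝ (⊤ : ℕ∞) h) (hhper : ZPeriodic n h)
    (Φ : ℝ → ℝ) (hΦC2 : ContDiff ℝ 2 Φ) (hΦconv : ConvexOn ℝ Set.univ Φ)
    (φ : (Fin n → ℝ) × ℝ → ℝ) (H : IsHarmonicExt n h h φ) :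
    0 ≤ ∫ x in cell n, deriv Φ (h x) * (pdE n φ (eY n) (x, h x)
      - ∑ i, pdX n h i x * pdE n φ (eX n i) (x, h x)) := by
  have hhc : Continuous h := hh.continuous
  have hpdh : ∀ i, Continuous (pdX n h i) := fun i => by
    unfold pdX
    exact (hh.continuous_fderiv (by simp)).clm_apply continuous_const
  obtain ⟨r, hr⟩ := (isCompact_Icc (a := (0 : Fin n → ℝ)) (b := 1)).exists_bound_of_continuousOn
    hhc.continuousOn
  have hex : ∀ i, ∃ C, ∀ x ∈ Set.Icc (0 : Fin n → ℝ) 1, ‖pdX n h i x‖ ≤ C := fun i =>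
    isCompact_Icc.exists_bound_of_continuousOn (hpdh i).continuousOn
  choose C hC using hex
  obtain ⟨g, hg, hg0, ⟨K, hK⟩, hgΦ⟩ := aux_trunc Φ hΦC2 hΦconv r
  have hφ1 : ContDiff ℝ 1 φ := H.smooth.of_le (by simp)
  have hP : ∀ v, ContDiff ℝ 1 (pdE n φ v) := fun v => by
    unfold pdE
    exact (H.smooth.fderiv_right (m := 1) (by norm_cast)).clm_apply contDiff_const
  have hPp : ∀ v, ZPeriodicE n (pdE n φ v) := fun v x y k => by
    have h1 : (fun p : (Fin n → ℝ) × ℝ => φ (p + ((fun i => (k i : ℝ)), 0))) = φ := by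
      funext p
      have := H.periodic p.1 p.2 k
      simpa [Prod.add_def] using this
    have h2 := fderiv_comp_add_right (𝕜 := ℝ) (f := φ) (x := (x, y))
      ((fun i => (k i : ℝ)), (0:ℝ))
    rw [h1] at h2
    unfold pdE
    rw [h2]; simp
  set A : (Fin n → ℝ) × ℝ → (Fin n → ℝ) × ℝ → ℝ := fun v p => g (φ p) * pdE n φ v p with hAdef
  have hA : ∀ v, ContDiff ℝ 1 (A v) := fun v => (hg.comp hφ1).mul (hP v)
  have hAp : ∀ v, ZPeriodicE n (A v) := fun v x y k => by
    simp only [hAdef, H.periodic x y k, hPp v x y k]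
  have hAd : ∀ v w p, pdE n (A v) w p =
      deriv g (φ p) * (pdE n φ v p * pdE n φ w p) + g (φ p) * pdE n (pdE n φ v) w p := by
    intro v w p
    have h1 : HasFDerivAt (fun p => g (φ p)) (deriv g (φ p) • fderiv ℝ φ p) p :=
      ((hg.differentiable (by norm_num) (φ p)).hasDerivAt).comp_hasFDerivAt p
        ((hφ1.differentiable (by norm_num) p).hasFDerivAt)
    have h2 := h1.mul (((hP v).differentiable (by norm_num) p).hasFDerivAt)
    have h3 : fderiv ℝ (A v) p = _ := h2.fderiv
    have h4 : pdE n (A v) w p = fderiv ℝ (A v) p w := rfl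
    rw [h4, h3]
    simp only [pdE, _root_.add_apply, _root_.smul_apply, smul_eq_mul]
    ring
  have hdiv : ∀ p : (Fin n → ℝ) × ℝ, p.2 < h p.1 →
      0 ≤ (∑ i, pdE n (A (eX n i)) (eX n i) p) + pdE n (A (eY n)) (eY n) p := by
    intro p hp
    have h1 := H.harmonic p hp
    have h2 : (∑ i, pdE n (A (eX n i)) (eX n i) p) + pdE n (A (eY n)) (eY n) p =
        deriv g (φ p) * gradSqE n φ p + g (φ p) * lapE n φ p := by
      simp only [hAd, Finset.sum_add_distrib, ← Finset.mul_sum, gradSqE, lapE, sq]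
      ring
    rw [h2, h1, mul_zero, add_zero]
    refine mul_nonneg (hg0 _) ?_
    unfold gradSqE
    positivity
  have hflux := aux_flux n hn h hh hhper (fun i => A (eX n i)) (A (eY n))
    (fun i => hA _) (hA _) (fun i => hAp _) hdiv
  have hI : ∫ x in cell n, deriv Φ (h x) * (pdE n φ (eY n) (x, h x)
      - ∑ i, pdX n h i x * pdE n φ (eX n i) (x, h x)) =
      ∫ x in cell n, (A (eY n) (x, h x) - ∑ i, pdX n h i x * A (eX n i) (x, h x)) := by
    refine setIntegral_congr_fun (aux_cell_meas n) fun x hx => ?_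
    have h1 : g (h x) = deriv Φ (h x) := hgΦ _ (hr x (aux_cell_sub n hx))
    simp only [hAdef, H.boundary, h1, mul_sub, Finset.mul_sum]
    congr 1
    exact Finset.sum_congr rfl fun i _ => by ring
  rw [hI]
  by_contra hneg
  rw [not_le] at hneg
  set I := ∫ x in cell n, (A (eY n) (x, h x) - ∑ i, pdX n h i x * A (eX n i) (x, h x))
  -- constants
  have hK0 : 0 ≤ K := (abs_nonneg _).trans (hK 0)
  obtain ⟨M, hM0, hMY, hMX⟩ : ∃ M : ℝ, 0 < M ∧ K ≤ M ∧
      ∀ i, ∀ x ∈ cell n, |pdX n h i x| * K ≤ M := by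
    refine ⟨1 + K + ∑ i, |C i| * K, by positivity, ?_, fun i x hx => ?_⟩
    · have : 0 ≤ ∑ i, |C i| * K := Finset.sum_nonneg fun i _ => by positivity
      linarith
    · have h1 : |pdX n h i x| * K ≤ |C i| * K := by
        exact mul_le_mul_of_nonneg_right
          ((hC i x (aux_cell_sub n hx)).trans (le_abs_self _)) hK0
      have h2 := Finset.single_le_sum (f := fun i => |C i| * K)
        (fun i _ => by positivity) (Finset.mem_univ i)
      linarith
  set δ : ℝ := -I / (2 * (n + 1)) with hδ
  have hn1 : (0:ℝ) < n + 1 := by positivity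
  have hδ0 : 0 < δ := div_pos (by linarith) (by positivity)
  set Q : ℝ := M ^ 2 / δ with hQ
  have hQ0 : 0 < Q := by positivity
  have young : ∀ t : ℝ, M * |t| ≤ δ + Q * t ^ 2 := by
    intro t
    have h1 : Q * t ^ 2 = (M * |t|) ^ 2 / δ := by
      rw [hQ, mul_pow, sq_abs]; ring
    rw [h1, ← sub_nonneg]
    have h2 : δ + (M * |t|) ^ 2 / δ - M * |t| = (δ ^ 2 + (M * |t|) ^ 2 - δ * (M * |t|)) / δ := by
      field_simp
    rw [h2]
    refine div_nonneg ?_ hδ0.le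
    nlinarith [sq_nonneg (δ - M * |t|), mul_nonneg hM0.le (abs_nonneg t)]
  have hpt : ∀ z, ∀ x ∈ cell n, -(A (eY n) (x, h x + z) -
      ∑ i, pdX n h i x * A (eX n i) (x, h x + z)) ≤
      (n + 1) * δ + Q * gradSqE n φ (x, h x + z) := by
    intro z x hx
    have hY : -(A (eY n) (x, h x + z)) ≤ δ + Q * (pdE n φ (eY n) (x, h x + z)) ^ 2 := by
      refine le_trans ?_ (young _)
      refine (neg_le_abs _).trans ?_
      simp only [hAdef, abs_mul]
      gcongr
      exact (hK _).trans hMY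
    have hX : ∀ i, pdX n h i x * A (eX n i) (x, h x + z) ≤
        δ + Q * (pdE n φ (eX n i) (x, h x + z)) ^ 2 := by
      intro i
      refine le_trans ?_ (young _)
      refine (le_abs_self _).trans ?_
      simp only [hAdef, abs_mul, ← mul_assoc]
      gcongr
      refine le_trans ?_ (hMX i x hx)
      gcongr
      exact hK _
    have hs := Finset.sum_le_sum fun i (_ : i ∈ Finset.univ) => hX i
    rw [Finset.sum_add_distrib, ← Finset.mul_sum] at hs
    simp only [Finset.sum_const, Finset.card_univ, Fintype.card_fin, nsmul_eq_mul] at hs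
    unfold gradSqE
    linarith
  have hP0 : ∀ v, Continuous (pdE n φ v) := fun v => (hP v).continuous
  have hA0 : ∀ v, Continuous (A v) := fun v => (hA v).continuous
  have hlow : ∀ z < 0, -I / 2 / Q ≤ ∫ x in cell n, gradSqE n φ (x, h x + z) := by
    intro z hz
    have h1 := hflux z hz.le
    have hc1 : Continuous fun x => A (eY n) (x, h x + z) -
      ∑ i, pdX n h i x * A (eX n i) (x, h x + z) := by fun_prop
    have hc2 : Continuous fun x => gradSqE n φ (x, h x + z) := by
      unfold gradSqE; fun_prop
    have hc3 : IntegrableOn (fun x => Q * gradSqE n φ (x, h x + z)) (cell n) :=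
      aux_int n (continuous_const.mul hc2)
    have h2 := setIntegral_mono_on (f := fun x => -(A (eY n) (x, h x + z) -
      ∑ i, pdX n h i x * A (eX n i) (x, h x + z)))
      (g := fun x => ((n:ℝ) + 1) * δ + Q * gradSqE n φ (x, h x + z)) (aux_int n hc1.neg)
      (aux_int n (continuous_const.add (continuous_const.mul hc2))) (aux_cell_meas n) (hpt z)
    rw [integral_neg, integral_add (aux_int n continuous_const)
      hc3, integral_const_mul Q, setIntegral_const] at h2
    simp only [measureReal_def, aux_cell_vol, ENNReal.toReal_one, one_smul] at h2
    have h3 : ((n:ℝ) + 1) * δ = -I / 2 := by rw [hδ]; field_simp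
    rw [h3] at h2
    rw [div_le_iff₀ hQ0]
    linarith
  have hint := aux_shear n h hhc _ H.gradL2
  have hcst : IntegrableOn (fun _ : ℝ => -I / 2 / Q) (Set.Iio 0) := by
    refine Integrable.mono' hint aestronglyMeasurable_const ?_
    filter_upwards [ae_restrict_mem measurableSet_Iio] with z hz
    rw [Real.norm_of_nonneg (div_nonneg (by linarith) hQ0.le)]
    exact hlow z hz
  rw [integrableOn_const_iff] at hcst
  have hpos : 0 < -I / 2 / Q := div_pos (by linarith) hQ0
  rcases hcst with h1 | h1
  · rw [enorm_eq_zero] at h1; linarith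
  · simp at h1

/-- ∫ Φ'(h) G(h)h dx ≥ 0 for a C² convex Φ. -/
theorem DtN_convex_integral_nonneg (n : ℕ) (hn : 1 ≤ n) (h : (Fin n → ℝ) → ℝ)
    (hh : ContDiff ℝ (⊤ : ℕ∞) h) (hhper : ZPeriodic n h)
    (Φ : ℝ → ℝ) (hΦC2 : ContDiff ℝ 2 Φ) (hΦconv : ConvexOn ℝ Set.univ Φ) :
    0 ≤ ∫ x in cell n, deriv Φ (h x) * DtN n h h x := by
  unfold DtN
  split_ifs with H
  · exact aux_main n hn h hh hhper Φ hΦC2 hΦconv _ H.choose_spec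
  · simp

end
end
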